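/- Let R be a Noetherian unique factorization domain which is not a field, let f_1,...,f_n, f ∈ R with some f_i ≠ 0, let J = (f_1,...,f_n, f), and let A = R[T_1,...,T_n]/(f_1T_1 + ... + f_nT_n + f). Then A is an integral domain if and only if J = R or the height of J is at least 2. -/

import Mathlib

open MvPolynomial

noncomputable def idealHeight {R : Type*} [CommRing R] (I : Ideal R) : ℕ∞ :=
  ⨅ (P : PrimeSpectrum R) (_ : I ≤ P.asIdeal), Order.height P

theorem two_le_idealHeight_iff {R : Type*} [CommRing R] (I : Ideal R) :
    2 ≤ idealHeight I ↔ ∀ P : Ideal R, P.IsPrime → I ≤ P → 2 ≤ P.height := by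
  simp only [idealHeight, le_iInf_iff, ← PrimeSpectrum.height_eq_orderHeight]
  exact ⟨fun h P hP hI ↦ h ⟨P, hP⟩ hI, fun h P hI ↦ h P.asIdeal P.isPrime hI⟩

theorem two_le_idealHeight_span_iff {R : Type*} [CommRing R] [IsDomain R] [IsNoetherianRing R]
    [UniqueFactorizationMonoid R] {s : Set R} (hs : ∃ a ∈ s, a ≠ 0) :
    2 ≤ idealHeight (Ideal.span s) ↔ ∀ r, (∀ a ∈ s, r ∣ a) → IsUnit r := by
  rw [two_le_idealHeight_iff]
  constructor
  · intro H r hr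
    by_contra hu
    obtain ⟨P, hPm, hPr⟩ := Ideal.exists_le_maximal _ (mt Ideal.span_singleton_eq_top.mp hu)
    have := hPm.isPrime
    obtain ⟨Q, hQ, -⟩ := Ideal.exists_minimalPrimes_le hPr
    have hle : Ideal.span s ≤ Q := le_trans
      (Ideal.span_le.mpr fun a ha ↦ Ideal.mem_span_singleton.mpr (hr a ha)) hQ.le
    have h1 := Ideal.height_le_one_of_isPrincipal_of_mem_minimalPrimes _ Q hQ
    exact absurd ((H Q hQ.isPrime hle).trans h1) (by norm_num)
  · intro H P hP hle
    obtain ⟨a, ha, ha0⟩ := hs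
    have hbot : P ≠ ⊥ := fun h ↦ ha0 (by simpa [h] using hle (Ideal.subset_span ha))
    have h0 : P.height ≠ 0 := mt Ideal.height_eq_zero_iff_eq_bot.mp hbot
    by_contra! hlt
    have h1 : P.height = 1 := le_antisymm
      (Order.le_of_lt_add_one (by rwa [one_add_one_eq_two])) (Order.one_le_iff_ne_zero.mpr h0)
    obtain ⟨x, hxP, hx⟩ := hP.exists_mem_prime_of_ne_bot hbot
    have hPx := P.eq_span_singleton_of_height_eq_one h1 hxP hx
    exact hx.not_isUnit (H x fun b hb ↦
      Ideal.mem_span_singleton.mp (hPx ▸ hle (Ideal.subset_span hb)))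

section LinearPolynomial

variable {R σ : Type*} [CommRing R] [Fintype σ] (f : σ → R) (f₀ : R)

theorem coeff_single_linear (i : σ) :
    coeff (Finsupp.single i 1) (∑ j, C (f j) * X j + C f₀) = f i := by
  classical
  simp [coeff_sum, coeff_C_mul, coeff_X, coeff_C, Finsupp.single_left_inj,
    eq_comm (a := (0 : σ →₀ ℕ))]

theorem coeff_zero_linear : coeff 0 (∑ j, C (f j) * X j + C f₀) = f₀ := by
  simp [coeff_sum]

theorem C_dvd_linear_iff (r : R) :
    C r ∣ ∑ j, C (f j) * X j + C f₀ ↔ ∀ a ∈ insert f₀ (Set.range f), r ∣ a := by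
  constructor
  · rw [C_dvd_iff_dvd_coeff]
    rintro h a (rfl | ⟨i, rfl⟩)
    · simpa only [coeff_zero_linear] using h 0
    · simpa only [coeff_single_linear] using h (Finsupp.single i 1)
  · intro h
    exact dvd_add (Finset.dvd_sum fun j _ ↦ (map_dvd C (h _ (by simp))).mul_right _)
      (map_dvd C (h _ (by simp)))

variable {f}

theorem totalDegree_linear (hf : ∃ i, f i ≠ 0) :
    (∑ j, C (f j) * X j + C f₀).totalDegree = 1 := by
  obtain ⟨i, hi⟩ := hf
  have : Nontrivial R := ⟨⟨_, _, hi⟩⟩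
  apply le_antisymm
  · refine (totalDegree_add _ _).trans (max_le (totalDegree_finsetSum_le fun j _ ↦ ?_) (by simp))
    exact (totalDegree_mul _ _).trans (by simp)
  · simpa using le_totalDegree (s := Finsupp.single i 1)
      (mem_support_iff.mpr ((coeff_single_linear f f₀ i).trans_ne hi))

theorem irreducible_linear_iff [IsDomain R] (hf : ∃ i, f i ≠ 0) :
    Irreducible (∑ j, C (f j) * X j + C f₀) ↔
      ∀ r, (∀ a ∈ insert f₀ (Set.range f), r ∣ a) → IsUnit r := by
  have hdeg := totalDegree_linear f₀ hf
  constructor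
  · intro h r hr
    obtain ⟨g, hg⟩ := (C_dvd_linear_iff f f₀ r).mpr hr
    rcases h.isUnit_or_isUnit hg with hu | hu
    · simpa using hu
    · have := totalDegree_mul (C r) g
      rw [← hg, hdeg, (isUnit_iff_totalDegree_of_isReduced.mp hu).2] at this
      simp at this
  · exact fun H ↦ irreducible_of_totalDegree_eq_one hdeg fun r hr ↦
      H r ((C_dvd_linear_iff f f₀ r).mp ((C_dvd_iff_dvd_coeff _ _).mpr hr))

end LinearPolynomial

theorem forcing_algebra_domain_iff_ufd {R : Type*} [CommRing R] [IsDomain R]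
    [IsNoetherianRing R] [UniqueFactorizationMonoid R] (hnf : ¬ IsField R)
    (n : ℕ) (f : Fin n → R) (f₀ : R) (hne : ∃ i, f i ≠ 0)
    (h : MvPolynomial (Fin n) R) (hh : h = ∑ i, C (f i) * X i + C f₀) :
    IsDomain (MvPolynomial (Fin n) R ⧸ Ideal.span {h}) ↔
      (Ideal.span (insert f₀ (Set.range f)) = ⊤ ∨
        2 ≤ idealHeight (Ideal.span (insert f₀ (Set.range f)))) := by
  have htop (hJ : Ideal.span (insert f₀ (Set.range f)) = ⊤) :
      2 ≤ idealHeight (Ideal.span (insert f₀ (Set.range f))) :=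
    (two_le_idealHeight_iff _).mpr fun P hP hle ↦ absurd (top_le_iff.mp (hJ ▸ hle)) hP.ne_top
  have hs : ∃ a ∈ insert f₀ (Set.range f), a ≠ 0 :=
    hne.elim fun i hi ↦ ⟨f i, by simp, hi⟩
  have h0 : h ≠ 0 := by
    rintro rfl
    simpa [← hh] using totalDegree_linear f₀ hne
  rw [or_iff_right_of_imp htop, two_le_idealHeight_span_iff hs, ← irreducible_linear_iff f₀ hne,
    ← hh, UniqueFactorizationMonoid.irreducible_iff_prime, ← Ideal.span_singleton_prime h0,
    Ideal.Quotient.isDomain_iff_prime]
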